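/- For every n × n matrix A with nonnegative real entries, sm(A) = lim_{m→∞} pm(A ⊗ Uₘ), where Uₘ is the m × m matrix all of whose entries are 1 and ⊗ denotes the Kronecker product. -/

import Mathlib

open scoped BigOperators Kronecker
open Matrix

/-- The permanent of a square real matrix. -/
noncomputable def perm {ι : Type*} [Fintype ι] [DecidableEq ι] (A : Matrix ι ι ℝ) : ℝ :=
  ∑ σ : Equiv.Perm ι, ∏ i, A i (σ i)

/-- The permanental mean `pm A = (per A / n!) ^ (1/n)`. -/
noncomputable def pm {ι : Type*} [Fintype ι] [DecidableEq ι] (A : Matrix ι ι ℝ) : ℝ :=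
  (perm A / (Nat.factorial (Fintype.card ι) : ℝ)) ^ ((Fintype.card ι : ℝ)⁻¹)

/-- The geometric mean of the entries of a vector. -/
noncomputable def gmVec {ι : Type*} [Fintype ι] (v : ι → ℝ) : ℝ :=
  (∏ i, v i) ^ ((Fintype.card ι : ℝ)⁻¹)

/-- The set of values whose infimum defines the scaling mean. -/
noncomputable def smSet {ι κ : Type*} [Fintype ι] [Fintype κ] (A : Matrix ι κ ℝ) : Set ℝ :=
  {r : ℝ | ∃ x : ι → ℝ, ∃ y : κ → ℝ, (∀ i, 0 < x i) ∧ (∀ j, 0 < y j) ∧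
    r = (∑ i, ∑ j, x i * A i j * y j) / (gmVec x * gmVec y)}

/-- The scaling mean `sm A = (1/(mn)) · inf over positive vectors x, y of xᵀAy/(gm x · gm y)`. -/
noncomputable def sm {ι κ : Type*} [Fintype ι] [Fintype κ] (A : Matrix ι κ ℝ) : ℝ :=
  ((Fintype.card ι : ℝ) * (Fintype.card κ : ℝ))⁻¹ * sInf (smSet A)


section Counting

theorem perm_fiber_le {I J : Type*} [Fintype I] [DecidableEq I] [Fintype J] [DecidableEq J]
    (f g : I → J) :
    (Finset.univ.filter (fun α : Equiv.Perm I => f ∘ α = g)).card ≤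
      ∏ j, (Fintype.card {a // f a = j}).factorial := by
  rw [← DomMulAct.stabilizer_card f, Fintype.card_subtype]
  rcases (Finset.univ.filter (fun α : Equiv.Perm I => f ∘ α = g)).eq_empty_or_nonempty with h | ⟨β, hβ⟩
  · rw [h]; simp
  · simp only [Finset.mem_filter, Finset.mem_univ, true_and] at hβ
    refine Finset.card_le_card_of_injOn (fun α => α * β⁻¹) ?_ ?_
    · intro α hα
      simp only [Finset.coe_filter, Finset.mem_univ, true_and, Set.mem_ofPred_eq] at hα ⊢
      funext i
      have h1 := congrFun hα (β.symm i)
      have h2 := congrFun hβ (β.symm i)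
      simp only [Function.comp, Equiv.apply_symm_apply] at h1 h2
      exact h1.trans h2.symm
    · intro a _ b _ hab
      simpa using hab

theorem sum_comp_perm_le {I J : Type*} [Fintype I] [DecidableEq I] [Fintype J] [DecidableEq J]
    (f : I → J) (φ : (I → J) → ℝ) (hφ : ∀ g, 0 ≤ φ g) :
    ∑ α : Equiv.Perm I, φ (f ∘ α) ≤
      ((∏ j, (Fintype.card {a // f a = j}).factorial : ℕ) : ℝ) * ∑ g, φ g := by
  rw [← Finset.sum_fiberwise (s := Finset.univ) (g := fun α : Equiv.Perm I => f ∘ α), Finset.mul_sum]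
  refine Finset.sum_le_sum fun g _ => ?_
  rw [Finset.sum_congr rfl (g := fun _ => φ g)]
  · rw [Finset.sum_const, nsmul_eq_mul]
    gcongr
    · exact hφ g
    · exact perm_fiber_le f g
  · intro α hα
    simp only [Finset.mem_filter, Finset.mem_univ, true_and] at hα
    rw [hα]

theorem card_fst_fiber {n m : ℕ} (j : Fin n) :
    Fintype.card {a : Fin n × Fin m // a.1 = j} = m := by
  rw [Fintype.card_subtype]
  have : (Finset.univ.filter (fun a : Fin n × Fin m => a.1 = j)) = {j} ×ˢ Finset.univ := by
    ext ⟨a, b⟩; simp [eq_comm]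
  rw [this]; simp

theorem perm_kron_eq {n m : ℕ} (B : Matrix (Fin n) (Fin n) ℝ) :
    perm (B ⊗ₖ (Matrix.of fun _ _ : Fin m => (1 : ℝ))) =
      ∑ σ : Equiv.Perm (Fin n × Fin m), ∏ t, B t.1 (σ t).1 := by
  simp [perm, Matrix.kroneckerMap_apply]

theorem perm_kron_upper {n m : ℕ} (B : Matrix (Fin n) (Fin n) ℝ) (hB : ∀ i j, 0 ≤ B i j) :
    ((n * m).factorial : ℝ) * perm (B ⊗ₖ (Matrix.of fun _ _ : Fin m => (1 : ℝ))) ≤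
      ((m.factorial : ℝ) ^ n) ^ 2 * (∑ i, ∑ j, B i j) ^ (n * m) := by
  have h1 : ((n * m).factorial : ℝ) * perm (B ⊗ₖ (Matrix.of fun _ _ : Fin m => (1 : ℝ))) =
      ∑ α : Equiv.Perm (Fin n × Fin m), ∑ β : Equiv.Perm (Fin n × Fin m),
        ∏ t, B (α t).1 (β t).1 := by
    have : ∀ α : Equiv.Perm (Fin n × Fin m), ∑ β : Equiv.Perm (Fin n × Fin m),
        ∏ t, B (α t).1 (β t).1 = perm (B ⊗ₖ (Matrix.of fun _ _ : Fin m => (1 : ℝ))) := by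
      intro α
      rw [perm_kron_eq, ← Equiv.sum_comp (Equiv.mulRight α)]
      refine Finset.sum_congr rfl fun σ _ => ?_
      exact Equiv.prod_comp α (fun t => B t.1 (σ t).1)
    simp [this, Fintype.card_perm]
  have hC : ((∏ j : Fin n, (Fintype.card {a : Fin n × Fin m // a.1 = j}).factorial : ℕ) : ℝ) =
      (m.factorial : ℝ) ^ n := by
    simp [card_fst_fiber]
  have hnn : ∀ g h : Fin n × Fin m → Fin n, 0 ≤ ∏ t, B (g t) (h t) :=
    fun g h => Finset.prod_nonneg fun t _ => hB _ _
  have h2 : ∀ g : Fin n × Fin m → Fin n, ∑ β : Equiv.Perm (Fin n × Fin m),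
        ∏ t, B (g t) (β t).1 ≤ (m.factorial : ℝ) ^ n * ∑ h : Fin n × Fin m → Fin n, ∏ t, B (g t) (h t) := by
    intro g
    have := sum_comp_perm_le (Prod.fst : Fin n × Fin m → Fin n)
      (fun h => ∏ t, B (g t) (h t)) (hnn g)
    rwa [hC] at this
  rw [h1]
  calc _ ≤ ∑ α : Equiv.Perm (Fin n × Fin m), (m.factorial : ℝ) ^ n *
            ∑ h : Fin n × Fin m → Fin n, ∏ t, B (α t).1 (h t) :=
          Finset.sum_le_sum fun α _ => h2 (fun t => (α t).1)
    _ = (m.factorial : ℝ) ^ n * ∑ α : Equiv.Perm (Fin n × Fin m), 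
            ∑ h : Fin n × Fin m → Fin n, ∏ t, B (α t).1 (h t) := by rw [Finset.mul_sum]
    _ ≤ (m.factorial : ℝ) ^ n * ((m.factorial : ℝ) ^ n * 
          ∑ g : Fin n × Fin m → Fin n, ∑ h : Fin n × Fin m → Fin n, ∏ t, B (g t) (h t)) := by
        gcongr
        have := sum_comp_perm_le (Prod.fst : Fin n × Fin m → Fin n)
          (fun g => ∑ h : Fin n × Fin m → Fin n, ∏ t, B (g t) (h t))
          (fun g => Finset.sum_nonneg fun h _ => hnn g h)
        rwa [hC] at this
    _ = _ := by
        have : ∑ g : Fin n × Fin m → Fin n, ∑ h : Fin n × Fin m → Fin n, ∏ t, B (g t) (h t)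
            = (∑ i, ∑ j, B i j) ^ (n * m) := by
          calc _ = ∑ g : Fin n × Fin m → Fin n, ∏ t, ∑ j, B (g t) j := by
                refine Finset.sum_congr rfl fun g _ => ?_
                rw [Fintype.prod_sum]
            _ = ∏ t : Fin n × Fin m, ∑ i, ∑ j, B i j := by
                rw [Fintype.prod_sum]
            _ = _ := by simp
        rw [this]; ring

theorem perm_kron_lower {n m : ℕ} (A : Matrix (Fin n) (Fin n) ℝ) (hA : ∀ i j, 0 ≤ A i j)
    (s : Fin m → Equiv.Perm (Fin n)) (k : Fin n → Fin n → ℕ)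
    (hk : ∀ i j, k i j = (Finset.univ.filter (fun l => s l i = j)).card) :
    ((m.factorial : ℝ) ^ n) ^ 2 * ∏ i, ∏ j, A i j ^ k i j ≤
      perm (A ⊗ₖ (Matrix.of fun _ _ : Fin m => (1 : ℝ))) * ∏ i, ∏ j, ((k i j).factorial : ℝ) := by
  classical
  let σ₀ : Equiv.Perm (Fin n × Fin m) :=
    { toFun := fun t => (s t.2 t.1, t.2)
      invFun := fun t => ((s t.2).symm t.1, t.2)
      left_inv := fun t => by simp
      right_inv := fun t => by simp }
  let f : Fin n × Fin m → Fin n × Fin n := fun t => (t.1, (σ₀ t).1)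
  have hf : ∀ p : Fin n × Fin n, Fintype.card {a // f a = p} = k p.1 p.2 := by
    rintro ⟨i, j⟩
    rw [hk, Fintype.card_subtype]
    have : (Finset.univ.filter (fun a => f a = (i, j))) =
       {i} ×ˢ (Finset.univ.filter (fun l => s l i = j)) := by
      ext ⟨a, b⟩
      simp only [f, σ₀, Equiv.coe_fn_mk, Finset.mem_filter, Finset.mem_univ, true_and,
        Prod.mk.injEq, Finset.mem_product, Finset.mem_singleton]
      constructor
      · rintro ⟨rfl, h⟩; exact ⟨rfl, h⟩
      · rintro ⟨rfl, h⟩; exact ⟨rfl, h⟩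
    rw [this]; simp
  have hfprod : ((∏ p, (Fintype.card {a // f a = p}).factorial : ℕ) : ℝ) =
      ∏ i, ∏ j, ((k i j).factorial : ℝ) := by
    simp only [hf]
    rw [Fintype.prod_prod_type]; push_cast; rfl
  have hval : ∏ t, A t.1 (σ₀ t).1 = ∏ i, ∏ j, A i j ^ k i j := by
    rw [← Fintype.prod_prod_type' (f := fun i j => A i j ^ k i j)]
    rw [← Finset.prod_fiberwise (s := Finset.univ) (g := f)]
    refine Finset.prod_congr rfl fun p _ => ?_
    rw [← hf p, Fintype.card_subtype]
    rw [Finset.prod_congr rfl (g := fun _ => A p.1 p.2), Finset.prod_const]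
    intro t ht
    simp only [Finset.mem_filter, Finset.mem_univ, true_and] at ht
    rw [← ht]
  let G := Finset.univ.filter (fun g : Equiv.Perm (Fin n × Fin m) => Prod.fst ∘ g = Prod.fst)
  have hG : G.card = m.factorial ^ n := by
    have := DomMulAct.stabilizer_card (Prod.fst : Fin n × Fin m → Fin n)
    rw [Fintype.card_subtype] at this
    simp only [G, this, card_fst_fiber]; simp
  -- sum over pairs
  have hsum : ((m.factorial : ℝ) ^ n) ^ 2 * ∏ i, ∏ j, A i j ^ k i j =
      ∑ p ∈ G ×ˢ G, ∏ t, A t.1 ((p.2 * σ₀ * p.1) t).1 := by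
    rw [Finset.sum_congr rfl (g := fun _ => ∏ i, ∏ j, A i j ^ k i j)]
    · rw [Finset.sum_const, Finset.card_product, hG, nsmul_eq_mul]; push_cast; ring
    · rintro ⟨g, h⟩ hp
      simp only [G, Finset.mem_product, Finset.mem_filter, Finset.mem_univ, true_and] at hp
      rw [← hval, ← Equiv.prod_comp g (fun t => A t.1 (σ₀ t).1)]
      refine Finset.prod_congr rfl fun t _ => ?_
      have e1 := congrFun hp.1 t
      have e2 := congrFun hp.2 (σ₀ (g t))
      simp only [Function.comp] at e1 e2
      simp [e1, e2]
  rw [hsum, perm_kron_eq, ← hfprod, Finset.sum_mul,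
    ← Finset.sum_fiberwise (s := G ×ˢ G) (g := fun p => p.2 * σ₀ * p.1)]
  refine Finset.sum_le_sum fun τ _ => ?_
  rw [Finset.sum_congr rfl (g := fun _ => ∏ t, A t.1 (τ t).1)]
  · rw [Finset.sum_const, nsmul_eq_mul, mul_comm]
    gcongr
    · exact Finset.prod_nonneg fun t _ => hA _ _
    · refine le_trans ?_ (perm_fiber_le f (fun t => (t.1, (τ t).1)))
      refine Finset.card_le_card_of_injOn Prod.fst ?_ ?_
      · rintro ⟨g, h⟩ hp
        simp only [G, Finset.coe_filter, Finset.mem_product, Finset.mem_filter, Finset.mem_univ,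
          true_and, Set.mem_ofPred_eq] at hp ⊢
        obtain ⟨⟨hg, hh⟩, rfl⟩ := hp
        funext t
        have e1 := congrFun hg t
        have e2 := congrFun hh (σ₀ (g t))
        simp only [Function.comp] at e1 e2
        simp [f, e1, e2]
      · rintro ⟨g, h⟩ hp ⟨g', h'⟩ hp' hgg
        simp only [Finset.coe_filter, Set.mem_ofPred_eq] at hp hp' hgg
        subst hgg
        have := hp.2.trans hp'.2.symm
        simpa using this
  · rintro p hp
    rw [(Finset.mem_filter.1 hp).2]

end Counting

section Asym
open Filter Topology Real

theorem log_factorial_bounds (k : ℕ) :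
    |log (k.factorial : ℝ) - (k * log k - k)| ≤ log (k + 1 : ℝ) + 1 := by
  rcases Nat.eq_zero_or_pos k with rfl | hk
  · simp
  have hk1 : (1:ℝ) ≤ k := by exact_mod_cast hk
  have hlow : k * log k - k ≤ log (k.factorial : ℝ) := by
    have h := Stirling.le_log_factorial_stirling (n := k) (by omega)
    have h1 : 0 ≤ log (k : ℝ) := log_nonneg hk1
    have h2 : 0 ≤ log (2 * π) := log_nonneg (by linarith [pi_gt_three])
    linarith
  have hup : log (k.factorial : ℝ) ≤ k * log k - k + log k + 1 := by
    clear hlow hk1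
    induction k, hk using Nat.le_induction with
    | base => norm_num
    | succ k hk ih =>
      have hk1 : (0:ℝ) < k := by exact_mod_cast hk
      have h3 : 1 - ((k + 1 : ℝ) / k)⁻¹ ≤ log ((k + 1 : ℝ) / k) :=
        one_sub_inv_le_log_of_pos (by positivity)
      rw [log_div (by positivity) (by positivity)] at h3
      have h4 : (k + 1 : ℝ) * (1 - ((k + 1 : ℝ) / k)⁻¹) = 1 := by field_simp; ring
      have h5 := mul_le_mul_of_nonneg_left h3 (by positivity : (0:ℝ) ≤ k + 1)
      rw [h4] at h5
      rw [Nat.factorial_succ]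
      push_cast
      rw [log_mul (by positivity) (by positivity)]
      nlinarith
  have h6 : log (k : ℝ) ≤ log (k + 1 : ℝ) := log_le_log (by positivity) (by linarith)
  have h7 : 0 ≤ log (k : ℝ) := log_nonneg hk1
  rw [abs_le]; constructor <;> linarith

theorem asym {k : ℕ → ℕ} {d : ℝ} 
    (h : Tendsto (fun m : ℕ => (k m : ℝ) / m) atTop (𝓝 d)) :
    Tendsto (fun m : ℕ => (log ((k m).factorial : ℝ) - k m * log m) / m) atTop
      (𝓝 (- negMulLog d - d)) := by
  have h1 : Tendsto (fun m : ℕ => - negMulLog ((k m : ℝ) / m) - (k m : ℝ) / m) atTop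
      (𝓝 (- negMulLog d - d)) :=
    ((continuous_negMulLog.tendsto d).comp h).neg.sub h
  have h2 : Tendsto (fun m : ℕ => (log (k m + 1 : ℝ) + 1) / m) atTop (𝓝 0) := by
    have hm : Tendsto (fun m : ℕ => (m : ℝ)) atTop atTop := tendsto_natCast_atTop_atTop
    have ha : Tendsto (fun m : ℕ => log (((k m : ℝ) / m) + 1 / m + 1) / m) atTop (𝓝 0) := by
      have h0 : Tendsto (fun m : ℕ => ((k m : ℝ) / m) + 1 / m + 1) atTop (𝓝 (d + 0 + 1)) :=
        (h.add tendsto_one_div_atTop_nhds_zero_nat).add_const 1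
      have hd : 0 ≤ d := ge_of_tendsto' h (fun m => by positivity)
      have := ((continuousAt_log (x := d + 0 + 1) (by positivity)).tendsto.comp h0)
      exact this.div_atTop hm
    have hb : Tendsto (fun m : ℕ => log (m : ℝ) / m) atTop (𝓝 0) := by
      have := (Real.isLittleO_log_id_atTop.tendsto_div_nhds_zero).comp hm
      exact this
    have hc : Tendsto (fun m : ℕ => (1 : ℝ) / m) atTop (𝓝 0) := tendsto_one_div_atTop_nhds_zero_nat
    have hs := (ha.add hb).add hc
    simp only [add_zero] at hs
    refine tendsto_of_tendsto_of_tendsto_of_le_of_le' tendsto_const_nhds hs ?_ ?_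
    · refine Eventually.of_forall fun m => ?_
      have : 0 ≤ log ((k m : ℝ) + 1) := log_nonneg (by linarith [(k m).cast_nonneg (α := ℝ)])
      positivity
    · filter_upwards [eventually_ge_atTop 1] with m hm1
      have hm1' : (1 : ℝ) ≤ m := by exact_mod_cast hm1
      rw [← add_div, ← add_div, ← log_mul (by positivity) (by positivity)]
      gcongr
      have : ((k m : ℝ) / m + 1 / m + 1) * m = k m + 1 + m := by field_simp
      rw [this]; linarith
  have h3 : Tendsto (fun m : ℕ => (log ((k m).factorial : ℝ) - k m * log m) / m - 
      (- negMulLog ((k m : ℝ) / m) - (k m : ℝ) / m)) atTop (𝓝 0) := by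
    refine squeeze_zero_norm' ?_ h2
    filter_upwards [eventually_ge_atTop 1] with m hm1
    have hm1' : (0 : ℝ) < m := by exact_mod_cast hm1
    have : (log ((k m).factorial : ℝ) - k m * log m) / m - 
      (- negMulLog ((k m : ℝ) / m) - (k m : ℝ) / m) = 
        (log ((k m).factorial : ℝ) - (k m * log (k m) - k m)) / m := by
      rw [negMulLog]
      rcases Nat.eq_zero_or_pos (k m) with h0 | h0
      · simp [h0]
      · rw [log_div (by positivity) (by positivity)]; field_simp; ring
    rw [this, norm_div, norm_natCast, norm_eq_abs]
    gcongr
    exact log_factorial_bounds _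
  simpa using h3.add h1

/-- Approximate a finite distribution by empirical distributions. -/
theorem empirical {T : Type*} [Fintype T] [DecidableEq T] (θ : T → ℝ) (h0 : ∀ t, 0 ≤ θ t)
    (h1 : ∑ t, θ t = 1) :
    ∃ s : ∀ m : ℕ, Fin m → T, (∀ m l, 0 < θ (s m l)) ∧
      ∀ t, Tendsto (fun m : ℕ => 
        (((Finset.univ.filter (fun l => s m l = t)).card : ℕ) : ℝ) / m) atTop (𝓝 (θ t)) := by
  obtain ⟨τ, hτ⟩ : ∃ τ, 0 < θ τ := by
    by_contra! h
    have : ∑ t, θ t ≤ 0 := Finset.sum_nonpos fun t _ => h t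
    linarith
  let q : ℕ → T → ℕ := fun m t => if t = τ then m - ∑ u ∈ Finset.univ.erase τ, ⌊m * θ u⌋₊ 
    else ⌊m * θ t⌋₊
  have hle : ∀ m : ℕ, ∑ u ∈ Finset.univ.erase τ, ⌊m * θ u⌋₊ ≤ m := by
    intro m
    have : (∑ u ∈ Finset.univ.erase τ, (⌊m * θ u⌋₊ : ℝ)) ≤ m := by
      calc _ ≤ ∑ u ∈ Finset.univ.erase τ, m * θ u := 
            Finset.sum_le_sum fun u _ => Nat.floor_le (mul_nonneg m.cast_nonneg (h0 u))
        _ ≤ ∑ u, m * θ u := Finset.sum_le_sum_of_subset_of_nonneg (Finset.erase_subset _ _)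
            fun u _ _ => (mul_nonneg m.cast_nonneg (h0 u))
        _ = m := by rw [← Finset.mul_sum, h1, mul_one]
    exact_mod_cast this
  have hq : ∀ m, ∑ t, q m t = m := by
    intro m
    rw [← Finset.add_sum_erase _ _ (Finset.mem_univ τ)]
    have : ∑ t ∈ Finset.univ.erase τ, q m t = ∑ u ∈ Finset.univ.erase τ, ⌊m * θ u⌋₊ :=
      Finset.sum_congr rfl fun t ht => by simp [q, (Finset.mem_erase.1 ht).1]
    rw [this]; simp only [q, if_true]
    have := hle m
    omega
  have e : ∀ m, Nonempty (Fin m ≃ Σ t, Fin (q m t)) := fun m => by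
    refine ⟨Fintype.equivOfCardEq ?_⟩
    simp [hq]
  let e' := fun m => Classical.choice (e m)
  have hfl : ∀ t, Tendsto (fun m : ℕ => ((⌊m * θ t⌋₊ : ℕ) : ℝ) / m) atTop (𝓝 (θ t)) := by
    intro t
    have := (tendsto_nat_floor_mul_div_atTop (R := ℝ) (h0 t)).comp tendsto_natCast_atTop_atTop
    simpa [Function.comp_def, mul_comm] using this
  have hcard : ∀ m t, (Finset.univ.filter (fun l => (e' m l).1 = t)).card = q m t := by
    intro m t
    rw [← Fintype.card_subtype]
    rw [Fintype.card_congr ((e' m).subtypeEquiv (p := fun l => (e' m l).1 = t) (q := fun x => x.1 = t) (fun a => Iff.rfl))]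
    rw [Fintype.card_congr (Equiv.sigmaSubtype t)]
    simp
  refine ⟨fun m l => (e' m l).1, ?_, ?_⟩
  · intro m l
    by_contra hcon
    have hz : θ (e' m l).1 = 0 := le_antisymm (not_lt.1 hcon) (h0 _)
    have hne : (e' m l).1 ≠ τ := by intro h; rw [h] at hz; linarith
    have h2 := (e' m l).2.2
    simp [q, hne, hz] at h2
  · intro t
    simp only [hcard]
    by_cases ht : t = τ
    · subst ht
      have hlim : Tendsto (fun m : ℕ => 1 - ∑ u ∈ Finset.univ.erase t, ((⌊m * θ u⌋₊ : ℕ) : ℝ) / m)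
          atTop (𝓝 (1 - ∑ u ∈ Finset.univ.erase t, θ u)) :=
        tendsto_const_nhds.sub (tendsto_finsetSum _ fun u _ => hfl u)
      have hv : 1 - ∑ u ∈ Finset.univ.erase t, θ u = θ t := by
        rw [← h1, ← Finset.add_sum_erase _ _ (Finset.mem_univ t)]; ring
      rw [hv] at hlim
      refine hlim.congr' ?_
      filter_upwards [eventually_ge_atTop 1] with m hm1
      have hm1' : (0 : ℝ) < m := by exact_mod_cast hm1
      simp only [q, if_true]
      rw [Nat.cast_sub (hle m), sub_div, div_self hm1'.ne', Nat.cast_sum, Finset.sum_div]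
    · simpa only [q, ht, if_false] using hfl t

end Asym

section Dual
open Filter Topology Real Set

/-- Simplex of distributions on the support of `A`. -/
def suppSimplex {n : ℕ} (A : Matrix (Fin n) (Fin n) ℝ) : Set (Fin n → Fin n → ℝ) :=
  {K | (∀ i j, 0 ≤ K i j) ∧ (∑ i, ∑ j, K i j = 1) ∧ ∀ i j, A i j = 0 → K i j = 0}

/-- The Lagrangian. -/
noncomputable def lagr {n : ℕ} (A : Matrix (Fin n) (Fin n) ℝ)
    (w : (Fin n → ℝ) × (Fin n → ℝ)) (K : Fin n → Fin n → ℝ) : ℝ :=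
  ∑ i, ∑ j, (negMulLog (K i j) + K i j * (log (A i j) + w.1 i + w.2 j)) -
    ((∑ i, w.1 i) + ∑ j, w.2 j) / n

theorem suppSimplex_convex {n : ℕ} (A : Matrix (Fin n) (Fin n) ℝ) : Convex ℝ (suppSimplex A) := by
  intro K hK L hL a b ha hb hab
  refine ⟨fun i j => ?_, ?_, fun i j h => ?_⟩
  · have := hK.1 i j
    have := hL.1 i j
    simp only [Pi.add_apply, Pi.smul_apply, smul_eq_mul]; positivity
  · simp only [Pi.add_apply, Pi.smul_apply, smul_eq_mul, Finset.sum_add_distrib, ← Finset.mul_sum,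
      hK.2.1, hL.2.1]; simpa using hab
  · simp [hK.2.2 i j h, hL.2.2 i j h]

theorem suppSimplex_compact {n : ℕ} (A : Matrix (Fin n) (Fin n) ℝ) :
    IsCompact (suppSimplex A) := by
  have hsub : suppSimplex A ⊆ Icc (0 : Fin n → Fin n → ℝ) 1 := by
    intro K hK
    refine ⟨fun i j => hK.1 i j, fun i j => ?_⟩
    rw [Pi.one_apply, Pi.one_apply, ← hK.2.1]
    calc K i j ≤ ∑ j, K i j := Finset.single_le_sum (fun j _ => hK.1 i j) (Finset.mem_univ j)
      _ ≤ _ := Finset.single_le_sum (f := fun i => ∑ j, K i j)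
        (fun i _ => Finset.sum_nonneg fun j _ => hK.1 i j) (Finset.mem_univ i)
  refine isCompact_Icc.of_isClosed_subset ?_ hsub
  have h1 : IsClosed {K : Fin n → Fin n → ℝ | ∀ i j, 0 ≤ K i j} := by
    simp only [ofPred_forall]
    exact isClosed_iInter fun i => isClosed_iInter fun j =>
      isClosed_le continuous_const (by fun_prop)
  have h2 : IsClosed {K : Fin n → Fin n → ℝ | ∑ i, ∑ j, K i j = 1} :=
    isClosed_eq (by fun_prop) continuous_const
  have h3 : IsClosed {K : Fin n → Fin n → ℝ | ∀ i j, A i j = 0 → K i j = 0} := by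
    simp only [ofPred_forall]
    exact isClosed_iInter fun i => isClosed_iInter fun j => isClosed_iInter fun _ =>
      isClosed_eq (by fun_prop) continuous_const
  exact h1.inter (h2.inter h3)

theorem lagr_continuous_right {n : ℕ} (A : Matrix (Fin n) (Fin n) ℝ)
    (w : (Fin n → ℝ) × (Fin n → ℝ)) : Continuous (lagr A w) := by
  unfold lagr
  have := continuous_negMulLog
  fun_prop

theorem lagr_continuous_left {n : ℕ} (A : Matrix (Fin n) (Fin n) ℝ)
    (K : Fin n → Fin n → ℝ) : Continuous (fun w => lagr A w K) := by
  unfold lagr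
  fun_prop

theorem lagr_concave {n : ℕ} (A : Matrix (Fin n) (Fin n) ℝ)
    (w : (Fin n → ℝ) × (Fin n → ℝ)) : ConcaveOn ℝ (suppSimplex A) (lagr A w) := by
  refine ⟨suppSimplex_convex A, ?_⟩
  intro K hK L hL a b ha hb hab
  have key : ∀ i j, a * (negMulLog (K i j) + K i j * (log (A i j) + w.1 i + w.2 j)) +
      b * (negMulLog (L i j) + L i j * (log (A i j) + w.1 i + w.2 j)) ≤
      negMulLog ((a • K + b • L) i j) + (a • K + b • L) i j * (log (A i j) + w.1 i + w.2 j) := by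
    intro i j
    have := concaveOn_negMulLog.2 (mem_Ici.2 (hK.1 i j)) (mem_Ici.2 (hL.1 i j)) ha hb hab
    simp only [smul_eq_mul] at this
    simp only [Pi.add_apply, Pi.smul_apply, smul_eq_mul]
    linarith
  have hs := Finset.sum_le_sum fun i (_ : i ∈ Finset.univ) =>
    Finset.sum_le_sum fun j (_ : j ∈ Finset.univ) => key i j
  simp only [Finset.sum_add_distrib (f := fun _ => a * _), ← Finset.mul_sum] at hs
  unfold lagr
  simp only [smul_eq_mul]
  have hb' : b = 1 - a := by linarith
  set M := ((∑ i, w.1 i) + ∑ j, w.2 j) / (n : ℝ)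
  have : a * M + b * M = M := by rw [← add_mul, hab, one_mul]
  linarith

theorem lagr_affine_left {n : ℕ} (A : Matrix (Fin n) (Fin n) ℝ)
    (K : Fin n → Fin n → ℝ) : ConvexOn ℝ univ (fun w => lagr A w K) := by
  refine ⟨convex_univ, ?_⟩
  intro w _ z _ a b ha hb hab
  apply le_of_eq
  unfold lagr
  simp only [smul_eq_mul, mul_sub, Finset.mul_sum, Prod.fst_add, Prod.snd_add, Prod.smul_fst,
    Prod.smul_snd, Pi.add_apply, Pi.smul_apply, Finset.sum_add_distrib, mul_add, ← mul_assoc]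
  have hb' : b = 1 - a := by linarith
  have e : ∀ f : Fin n → Fin n → ℝ, ∑ i, ∑ j, f i j = ∑ i, ∑ j, a * f i j + ∑ i, ∑ j, b * f i j := by
    intro f
    simp only [← Finset.mul_sum]
    rw [← add_mul, hab, one_mul]
  rw [e (fun i j => negMulLog (K i j)), e (fun i j => K i j * log (A i j))]
  simp only [← Finset.mul_sum, mul_comm (K _ _) a, mul_comm (K _ _) b, mul_assoc]
  ring

/-- Duality. -/
theorem exists_dual {n : ℕ} (hn : 0 < n) (A : Matrix (Fin n) (Fin n) ℝ) (hA : ∀ i j, 0 ≤ A i j)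
    (hc : 0 < sInf (smSet A)) :
    ∃ K : Fin n → Fin n → ℝ, (∀ i j, 0 ≤ K i j) ∧ (∀ i j, A i j = 0 → K i j = 0) ∧
      (∀ i, ∑ j, K i j = 1 / n) ∧ (∀ j, ∑ i, K i j = 1 / n) ∧
      log (sInf (smSet A)) ≤ ∑ i, ∑ j, (negMulLog (K i j) + K i j * log (A i j)) := by
  set c := sInf (smSet A) with hcdef
  have hn' : (0 : ℝ) < n := by exact_mod_cast hn
  have hbdd : BddBelow (smSet A) := by
    refine ⟨0, ?_⟩
    rintro r ⟨x, y, hx, hy, rfl⟩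
    refine div_nonneg (Finset.sum_nonneg fun i _ => Finset.sum_nonneg fun j _ => ?_) ?_
    · exact mul_nonneg (mul_nonneg (hx i).le (hA i j)) (hy j).le
    · exact mul_nonneg (rpow_nonneg (Finset.prod_nonneg fun i _ => (hx i).le) _)
        (rpow_nonneg (Finset.prod_nonneg fun i _ => (hy i).le) _)
  -- for every w there is a good K
  have hgood : ∀ w : (Fin n → ℝ) × (Fin n → ℝ), ∃ K ∈ suppSimplex A, log c ≤ lagr A w K := by
    intro w
    set Z := ∑ i, ∑ j, exp (w.1 i) * A i j * exp (w.2 j) with hZ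
    have hgm : ∀ u : Fin n → ℝ, gmVec (fun i => exp (u i)) = exp ((∑ i, u i) / n) := by
      intro u
      rw [gmVec, ← exp_sum, ← exp_mul, Fintype.card_fin, div_eq_mul_inv]
    have hle : c ≤ Z / exp (((∑ i, w.1 i) + ∑ j, w.2 j) / n) := by
      refine csInf_le hbdd ⟨fun i => exp (w.1 i), fun j => exp (w.2 j), fun i => exp_pos _,
        fun j => exp_pos _, ?_⟩
      rw [hgm, hgm, ← exp_add, add_div]
    have hZpos : 0 < Z := by
      have := hc.trans_le hle
      by_contra h
      exact absurd this (not_lt.2 (div_nonpos_of_nonpos_of_nonneg (not_lt.1 h) (exp_pos _).le))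
    have hlog : log c ≤ log Z - ((∑ i, w.1 i) + ∑ j, w.2 j) / n := by
      have := log_le_log hc hle
      rwa [log_div hZpos.ne' (exp_pos _).ne', log_exp] at this
    refine ⟨fun i j => exp (w.1 i) * A i j * exp (w.2 j) / Z, ⟨?_, ?_, ?_⟩, ?_⟩
    · intro i j
      have := hA i j
      positivity
    · simp only [← Finset.sum_div]; exact div_self hZpos.ne'
    · intro i j h; simp [h]
    · refine hlog.trans_eq ?_
      unfold lagr
      congr 1
      have : ∀ i j, negMulLog (exp (w.1 i) * A i j * exp (w.2 j) / Z) +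
          exp (w.1 i) * A i j * exp (w.2 j) / Z * (log (A i j) + w.1 i + w.2 j) =
          exp (w.1 i) * A i j * exp (w.2 j) / Z * log Z := by
        intro i j
        rcases (hA i j).eq_or_lt with h | h
        · simp [← h]
        · rw [negMulLog, log_div (by positivity) hZpos.ne', log_mul (by positivity) (by positivity),
            log_mul (by positivity) (by positivity), log_exp, log_exp]; ring
      simp only [this, ← Finset.sum_mul, ← Finset.sum_div]
      rw [← hZ, div_self hZpos.ne', one_mul]
  have hne : (suppSimplex A).Nonempty := by
    obtain ⟨K, hK, _⟩ := hgood 0; exact ⟨K, hK⟩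
  let box : ℕ → Set ((Fin n → ℝ) × (Fin n → ℝ)) := fun T =>
    Icc (-(fun _ => (T : ℝ)), -(fun _ => (T : ℝ))) ((fun _ => (T : ℝ)), (fun _ => (T : ℝ)))
  let F : ℕ → Set (Fin n → Fin n → ℝ) := fun T =>
    suppSimplex A ∩ ⋂ w ∈ box T, {K | log c ≤ lagr A w K}
  have hF : (⋂ T, F T).Nonempty := by
    have hclosed : ∀ T, IsClosed (F T) := fun T =>
      (suppSimplex_compact A).isClosed.inter (isClosed_biInter fun w _ =>
        isClosed_le continuous_const (lagr_continuous_right A w))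
    refine IsCompact.nonempty_iInter_of_sequence_nonempty_isCompact_isClosed F ?_ ?_ ?_ hclosed
    · intro T K hK
      refine ⟨hK.1, ?_⟩
      simp only [mem_iInter] at *
      intro w hw
      refine (mem_iInter₂.1 hK.2) w ?_
      refine Icc_subset_Icc ?_ ?_ hw
      · refine ⟨fun i => ?_, fun i => ?_⟩ <;> simp
      · refine ⟨fun i => ?_, fun i => ?_⟩ <;> simp
    · intro T
      obtain ⟨a, ha, b, hb, hab⟩ := Sion.exists_isSaddlePointOn (X := box T) (Y := suppSimplex A)
        (f := lagr A) ⟨0, ⟨by constructor <;> intro i <;> simp, by constructor <;> intro i <;> simp⟩⟩ (convex_Icc _ _) isCompact_Icc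
        (fun K _ => (lagr_continuous_left A K).lowerSemicontinuous.lowerSemicontinuousOn _)
        (fun K _ => ((lagr_affine_left A K).subset (subset_univ _) (convex_Icc _ _)).quasiconvexOn)
        (suppSimplex_convex A) hne (suppSimplex_compact A)
        (fun w _ => (lagr_continuous_right A w).upperSemicontinuous.upperSemicontinuousOn _)
        (fun w _ => (lagr_concave A w).quasiconcaveOn)
      refine ⟨b, hb, mem_iInter₂.2 fun w hw => ?_⟩
      obtain ⟨K, hK, hKc⟩ := hgood a
      exact hKc.trans (hab w hw K hK)
    · exact (suppSimplex_compact A).of_isClosed_subset (hclosed 0) inter_subset_left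
  obtain ⟨K, hK⟩ := hF
  rw [mem_iInter] at hK
  have hKs := (hK 0).1
  have hall : ∀ w, log c ≤ lagr A w K := by
    intro w
    obtain ⟨T, hT⟩ := exists_nat_ge ‖w‖
    refine mem_iInter₂.1 (hK T).2 w ?_
    have h1 : ∀ i, |w.1 i| ≤ T := fun i =>
      ((norm_le_pi_norm w.1 i).trans (norm_fst_le w)).trans hT
    have h2 : ∀ i, |w.2 i| ≤ T := fun i =>
      ((norm_le_pi_norm w.2 i).trans (norm_snd_le w)).trans hT
    exact ⟨⟨fun i => (abs_le.1 (h1 i)).1, fun i => (abs_le.1 (h2 i)).1⟩,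
      ⟨fun i => (abs_le.1 (h1 i)).2, fun i => (abs_le.1 (h2 i)).2⟩⟩
  set G := ∑ i, ∑ j, (negMulLog (K i j) + K i j * log (A i j)) with hG
  have hlag : ∀ w, lagr A w K = G + ∑ i, w.1 i * (∑ j, K i j - 1 / n) +
      ∑ j, w.2 j * (∑ i, K i j - 1 / n) := by
    intro w
    have e1 : ∑ i, w.1 i * (∑ j, K i j - 1 / n) =
        ∑ i, ∑ j, K i j * w.1 i - (∑ i, w.1 i) / n := by
      simp only [mul_sub, Finset.sum_sub_distrib, Finset.mul_sum, Finset.sum_div]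
      congr 1
      · exact Finset.sum_congr rfl fun i _ => Finset.sum_congr rfl fun j _ => mul_comm _ _
      · exact Finset.sum_congr rfl fun i _ => by ring
    have e2 : ∑ j, w.2 j * (∑ i, K i j - 1 / n) =
        ∑ i, ∑ j, K i j * w.2 j - (∑ i, w.2 i) / n := by
      rw [Finset.sum_comm]
      simp only [mul_sub, Finset.sum_sub_distrib, Finset.mul_sum, Finset.sum_div]
      congr 1
      · exact Finset.sum_congr rfl fun i _ => Finset.sum_congr rfl fun j _ => mul_comm _ _
      · exact Finset.sum_congr rfl fun i _ => by ring
    rw [e1, e2, hG, lagr]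
    simp only [mul_add, Finset.sum_add_distrib]
    ring
  have hzero : ∀ p : ℝ, (∀ t : ℝ, log c ≤ G + t * p) → p = 0 := by
    intro p hp
    by_contra hne
    have := hp ((log c - G - 1) / p)
    rw [div_mul_cancel₀ _ hne] at this
    linarith
  refine ⟨K, hKs.1, hKs.2.2, ?_, ?_, ?_⟩
  · intro i
    have := hzero (∑ j, K i j - 1 / n) fun t => by
      have := hall (Pi.single i t, 0)
      rw [hlag] at this
      simpa [Pi.single_apply] using this
    linarith
  · intro j
    have := hzero (∑ i, K i j - 1 / n) fun t => by
      have := hall (0, Pi.single j t)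
      rw [hlag] at this
      simpa [Pi.single_apply] using this
    linarith
  · have := hall 0
    rw [hlag] at this
    simpa using this

end Dual

section Main
open Filter Topology Real

theorem bddBelow_smSet {n : ℕ} (A : Matrix (Fin n) (Fin n) ℝ) (hA : ∀ i j, 0 ≤ A i j) :
    ∀ r ∈ smSet A, 0 ≤ r := by
  rintro r ⟨x, y, hx, hy, rfl⟩
  refine div_nonneg (Finset.sum_nonneg fun i _ => Finset.sum_nonneg fun j _ => ?_) ?_
  · exact mul_nonneg (mul_nonneg (hx i).le (hA i j)) (hy j).le
  · exact mul_nonneg (rpow_nonneg (Finset.prod_nonneg fun i _ => (hx i).le) _)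
      (rpow_nonneg (Finset.prod_nonneg fun i _ => (hy i).le) _)

theorem perm_nonneg' {ι : Type*} [Fintype ι] [DecidableEq ι] (A : Matrix ι ι ℝ)
    (hA : ∀ i j, 0 ≤ A i j) : 0 ≤ perm A :=
  Finset.sum_nonneg fun _ _ => Finset.prod_nonneg fun _ _ => hA _ _

/-- normalised log factorial -/
noncomputable def lf (k m : ℕ) : ℝ := (log (k.factorial : ℝ) - k * log m) / m

theorem pm_kron_eq {n m : ℕ} (A : Matrix (Fin n) (Fin n) ℝ) :
    pm (A ⊗ₖ (Matrix.of fun _ _ : Fin m => (1 : ℝ))) =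
      (perm (A ⊗ₖ (Matrix.of fun _ _ : Fin m => (1 : ℝ))) / ((n * m).factorial : ℝ)) ^
        (((n * m : ℕ) : ℝ)⁻¹) := by
  simp [pm]

theorem gm_pow {n m : ℕ} (hn : 0 < n) (x : Fin n → ℝ) (hx : ∀ i, 0 < x i) :
    gmVec x ^ (n * m) = (∏ i, x i) ^ m := by
  rw [gmVec, Fintype.card_fin, pow_mul,
    Real.rpow_inv_natCast_pow (Finset.prod_nonneg fun i _ => (hx i).le) hn.ne']

theorem perm_scale {n m : ℕ} (A : Matrix (Fin n) (Fin n) ℝ) (x y : Fin n → ℝ) :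
    perm ((Matrix.of fun i j => x i * A i j * y j) ⊗ₖ (Matrix.of fun _ _ : Fin m => (1 : ℝ))) =
      (∏ i, x i) ^ m * (∏ i, y i) ^ m *
        perm (A ⊗ₖ (Matrix.of fun _ _ : Fin m => (1 : ℝ))) := by
  have hp : ∀ z : Fin n → ℝ, ∏ t : Fin n × Fin m, z t.1 = (∏ i, z i) ^ m := by
    intro z
    rw [Fintype.prod_prod_type]; simp [Finset.prod_pow]
  rw [perm_kron_eq, perm_kron_eq, Finset.mul_sum]
  refine Finset.sum_congr rfl fun σ _ => ?_
  simp only [Matrix.of_apply, Finset.prod_mul_distrib, hp]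
  rw [Equiv.prod_comp σ (fun t => y t.1), hp]
  ring

theorem pm_upper {n m : ℕ} (hn : 0 < n) (hm : 0 < m) (A : Matrix (Fin n) (Fin n) ℝ)
    (hA : ∀ i j, 0 ≤ A i j) (r : ℝ) (hr : r ∈ smSet A) :
    pm (A ⊗ₖ (Matrix.of fun _ _ : Fin m => (1 : ℝ))) ≤
      exp ((2 * n * lf m m - 2 * lf (n * m) m) / n) * r := by
  have hr0 := bddBelow_smSet A hA r hr
  have hn' : (0 : ℝ) < n := by exact_mod_cast hn
  have hm' : (0 : ℝ) < m := by exact_mod_cast hm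
  have hN : n * m ≠ 0 := by positivity
  obtain ⟨x, y, hx, hy, hrr⟩ := hr
  set p := perm (A ⊗ₖ (Matrix.of fun _ _ : Fin m => (1 : ℝ))) with hp
  have hp0 : 0 ≤ p := perm_nonneg' _ fun i j => by
    simp [Matrix.kroneckerMap_apply, hA]
  have hE : exp ((2 * n * lf m m - 2 * lf (n * m) m) / n) ^ (n * m) =
      ((m.factorial : ℝ) ^ n) ^ 2 / ((n * m).factorial : ℝ) ^ 2 := by
    rw [← exp_nat_mul, ← exp_log (show 0 < ((m.factorial : ℝ) ^ n) ^ 2 / ((n * m).factorial : ℝ) ^ 2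
      by positivity)]
    congr 1
    rw [log_div (by positivity) (by positivity), log_pow, log_pow, log_pow, lf, lf]
    push_cast
    field_simp
    ring
  have hmain := perm_kron_upper (m := m) (Matrix.of fun i j => x i * A i j * y j)
    (fun i j => mul_nonneg (mul_nonneg (hx i).le (hA i j)) (hy j).le)
  rw [perm_scale, ← hp] at hmain
  simp only [Matrix.of_apply] at hmain
  have hX : 0 < ∏ i, x i := Finset.prod_pos fun i _ => hx i
  have hY : 0 < ∏ i, y i := Finset.prod_pos fun i _ => hy i
  have hle : p / ((n * m).factorial : ℝ) ≤
      (exp ((2 * n * lf m m - 2 * lf (n * m) m) / n) * r) ^ (n * m) := by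
    rw [mul_pow, hE, hrr, div_pow, mul_pow, gm_pow hn x hx, gm_pow hn y hy, div_mul_div_comm,
      div_le_div_iff₀ (by positivity) (by positivity)]
    have := mul_le_mul_of_nonneg_right hmain (show 0 ≤ ((n * m).factorial : ℝ) by positivity)
    linarith
  rw [pm_kron_eq, ← hp]
  calc _ ≤ ((exp ((2 * n * lf m m - 2 * lf (n * m) m) / n) * r) ^ (n * m)) ^
        (((n * m : ℕ) : ℝ)⁻¹) := by
        apply rpow_le_rpow (by positivity) hle (by positivity)
    _ = _ := pow_rpow_inv_natCast (by positivity) hN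

theorem pm_lower {n m : ℕ} (hn : 0 < n) (hm : 0 < m) (A : Matrix (Fin n) (Fin n) ℝ)
    (hA : ∀ i j, 0 ≤ A i j) (s : Fin m → Equiv.Perm (Fin n)) (k : Fin n → Fin n → ℕ)
    (hk : ∀ i j, k i j = (Finset.univ.filter (fun l => s l i = j)).card)
    (hpos : ∀ l i, A i (s l i) ≠ 0) :
    exp ((2 * n * lf m m - lf (n * m) m - ∑ i, ∑ j, lf (k i j) m
      + ∑ i, ∑ j, (k i j : ℝ) / m * log (A i j)) / n) ≤
    pm (A ⊗ₖ (Matrix.of fun _ _ : Fin m => (1 : ℝ))) := by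
  have hn' : (0 : ℝ) < n := by exact_mod_cast hn
  have hm' : (0 : ℝ) < m := by exact_mod_cast hm
  have hN : n * m ≠ 0 := by positivity
  set p := perm (A ⊗ₖ (Matrix.of fun _ _ : Fin m => (1 : ℝ))) with hp
  have hsum : ∑ i, ∑ j, (k i j : ℝ) = n * m := by
    have : ∀ i, ∑ j, k i j = m := by
      intro i
      simp only [hk]
      rw [← Finset.card_eq_sum_card_fiberwise (f := fun l => s l i) (by intro x _; simp)]
      simp
    have h2 : ∀ i, ∑ j, (k i j : ℝ) = m := fun i => by exact_mod_cast this i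
    simp [h2]
  have hz : ∀ i j, 0 < A i j ^ k i j := by
    intro i j
    rcases Nat.eq_zero_or_pos (k i j) with h | h
    · rw [h]; simp
    · rw [hk, gt_iff_lt, Finset.card_pos] at h
      obtain ⟨l, hl⟩ := h
      simp only [Finset.mem_filter, Finset.mem_univ, true_and] at hl
      have := hpos l i
      rw [hl] at this
      exact pow_pos ((hA i j).lt_of_ne' this) _
  have hlow := perm_kron_lower A hA s k hk
  rw [← hp] at hlow
  set Q := ∏ i, ∏ j, ((k i j).factorial : ℝ) with hQ
  set R := ∏ i, ∏ j, A i j ^ k i j with hR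
  have hQ0 : 0 < Q := Finset.prod_pos fun i _ => Finset.prod_pos fun j _ => by positivity
  have hR0 : 0 < R := Finset.prod_pos fun i _ => Finset.prod_pos fun j _ => hz i j
  have hlQ : log Q = ∑ i, ∑ j, log ((k i j).factorial : ℝ) := by
    rw [hQ, log_prod (fun i _ => (Finset.prod_pos fun j _ => by positivity).ne')]
    refine Finset.sum_congr rfl fun i _ => ?_
    rw [log_prod (fun j _ => by positivity)]
  have hlR : log R = ∑ i, ∑ j, (k i j : ℝ) * log (A i j) := by
    rw [hR, log_prod (fun i _ => (Finset.prod_pos fun j _ => hz i j).ne')]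
    refine Finset.sum_congr rfl fun i _ => ?_
    rw [log_prod (fun j _ => (hz i j).ne')]
    refine Finset.sum_congr rfl fun j _ => ?_
    rw [log_pow]
  have e1 : ∑ i, ∑ j, lf (k i j) m = (log Q - n * m * log m) / m := by
    simp only [lf, ← Finset.sum_div, Finset.sum_sub_distrib, ← Finset.sum_mul, hsum, hlQ]
  have e2 : ∑ i, ∑ j, (k i j : ℝ) / m * log (A i j) = log R / m := by
    simp only [div_mul_eq_mul_div, ← Finset.sum_div, hlR]
  rw [e1, e2]
  set w := (2 * n * lf m m - lf (n * m) m - (log Q - n * m * log m) / m + log R / m) / n with hw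
  have hE : exp w ^ (n * m) =
      ((m.factorial : ℝ) ^ n) ^ 2 * R / (Q * ((n * m).factorial : ℝ)) := by
    rw [← exp_nat_mul, ← exp_log (show 0 < ((m.factorial : ℝ) ^ n) ^ 2 * R /
      (Q * ((n * m).factorial : ℝ)) by positivity)]
    congr 1
    rw [log_div (by positivity) (by positivity), log_mul (by positivity) (by positivity),
      log_mul (by positivity) (by positivity), log_pow, log_pow, hw, lf, lf]
    push_cast
    field_simp
    ring
  have hle : exp w ^ (n * m) ≤ p / ((n * m).factorial : ℝ) := by
    rw [hE, div_le_div_iff₀ (by positivity) (by positivity)]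
    have := mul_le_mul_of_nonneg_right hlow (show 0 ≤ ((n * m).factorial : ℝ) by positivity)
    linarith
  rw [pm_kron_eq, ← hp]
  calc exp w = (exp w ^ (n * m)) ^ (((n * m : ℕ) : ℝ)⁻¹) :=
        (pow_rpow_inv_natCast (by positivity) hN).symm
    _ ≤ _ := rpow_le_rpow (by positivity) hle (by positivity)

theorem lf_self_tendsto : Tendsto (fun m => lf m m) atTop (𝓝 (-1)) := by
  have : Tendsto (fun m : ℕ => ((m : ℕ) : ℝ) / m) atTop (𝓝 1) := by
    refine tendsto_const_nhds.congr' ?_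
    filter_upwards [eventually_ge_atTop 1] with m hm
    have : (m : ℝ) ≠ 0 := by positivity
    rw [div_self this]
  simpa [lf] using asym (k := fun m => m) this

theorem lf_mul_tendsto (n : ℕ) : Tendsto (fun m => lf (n * m) m) atTop
    (𝓝 (n * log n - n)) := by
  have : Tendsto (fun m : ℕ => ((n * m : ℕ) : ℝ) / m) atTop (𝓝 n) := by
    refine tendsto_const_nhds.congr' ?_
    filter_upwards [eventually_ge_atTop 1] with m hm
    have : (m : ℝ) ≠ 0 := by positivity
    push_cast
    field_simp
  have := asym (k := fun m => n * m) this
  simpa [lf, negMulLog] using this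

theorem lower_seq {n : ℕ} (hn : 0 < n) (A : Matrix (Fin n) (Fin n) ℝ)
    (hA : ∀ i j, 0 ≤ A i j) (hc : 0 < sInf (smSet A)) :
    ∃ L : ℕ → ℝ, ∃ ℓ : ℝ, Tendsto L atTop (𝓝 ℓ) ∧ sm A ≤ ℓ ∧
      ∀ m, 0 < m → L m ≤ pm (A ⊗ₖ (Matrix.of fun _ _ : Fin m => (1 : ℝ))) := by
  have hn' : (0 : ℝ) < n := by exact_mod_cast hn
  obtain ⟨K, hK0, hKA, hKr, hKc, hKG⟩ := exists_dual hn A hA hc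
  let D : Matrix (Fin n) (Fin n) ℝ := Matrix.of fun i j => n * K i j
  have hD : D ∈ doublyStochastic ℝ (Fin n) := by
    rw [mem_doublyStochastic_iff_sum]
    refine ⟨fun i j => mul_nonneg hn'.le (hK0 i j), fun i => ?_, fun j => ?_⟩
    · simp only [D, Matrix.of_apply, ← Finset.mul_sum, hKr]; field_simp
    · simp only [D, Matrix.of_apply, ← Finset.mul_sum, hKc]; field_simp
  obtain ⟨w, hw0, hw1, hwD⟩ := exists_eq_sum_perm_of_mem_doublyStochastic hD
  obtain ⟨s, hs, hlim⟩ := empirical w hw0 hw1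
  have hDij : ∀ i j, n * K i j = ∑ σ : Equiv.Perm (Fin n), if σ i = j then w σ else 0 := by
    intro i j
    have := congrFun (congrFun hwD i) j
    simp only [D, Matrix.of_apply] at this
    rw [← this, Matrix.sum_apply]
    refine Finset.sum_congr rfl fun σ _ => ?_
    simp [Equiv.Perm.permMatrix, PEquiv.toMatrix_apply, Equiv.toPEquiv_apply, eq_comm]
  let k : ℕ → Fin n → Fin n → ℕ := fun m i j => (Finset.univ.filter (fun l => s m l i = j)).card
  have hkd : ∀ i j, Tendsto (fun m => (k m i j : ℝ) / m) atTop (𝓝 (n * K i j)) := by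
    intro i j
    rw [hDij]
    have hk : ∀ m, (k m i j : ℝ) / m = ∑ σ : Equiv.Perm (Fin n), if σ i = j then
        (((Finset.univ.filter (fun l => s m l = σ)).card : ℕ) : ℝ) / m else 0 := by
      intro m
      have : k m i j = ∑ σ : Equiv.Perm (Fin n), if σ i = j then
        (Finset.univ.filter (fun l => s m l = σ)).card else 0 := by
        simp only [k]
        rw [Finset.card_eq_sum_card_fiberwise (f := fun l => s m l) (t := Finset.univ)
          (by intro x _; simp)]
        refine Finset.sum_congr rfl fun σ _ => ?_
        rw [Finset.filter_filter]
        split_ifs with h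
        · congr 1; ext l; simp only [Finset.mem_filter, Finset.mem_univ, true_and]
          constructor
          · exact fun h => h.2
          · rintro rfl; exact ⟨h, rfl⟩
        · rw [Finset.card_eq_zero, Finset.filter_eq_empty_iff]
          rintro l _ ⟨h1, rfl⟩
          exact h h1
      rw [this]; push_cast; rw [Finset.sum_div]
      refine Finset.sum_congr rfl fun σ _ => ?_
      split_ifs <;> simp
    simp only [hk]
    refine tendsto_finsetSum _ fun σ _ => ?_
    split_ifs
    · exact hlim σ
    · exact tendsto_const_nhds
  have hpos : ∀ m l i, A i (s m l i) ≠ 0 := by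
    intro m l i h0
    have h1 := hKA _ _ h0
    have h2 := hDij i (s m l i)
    rw [h1, mul_zero] at h2
    have h3 := (Finset.sum_eq_zero_iff_of_nonneg (fun σ _ => by
      split_ifs; exacts [hw0 σ, le_rfl])).1 h2.symm (s m l) (Finset.mem_univ _)
    simp only [if_true] at h3
    exact (hs m l).ne' h3
  refine ⟨_, exp ((2 * (n : ℝ) * -1 - (n * log n - n) -
      ∑ i, ∑ j, (-negMulLog (n * K i j) - n * K i j) +
      ∑ i, ∑ j, n * K i j * log (A i j)) / n), ?_, ?_, fun m hm => pm_lower hn hm A hA (s m) (k m) (fun i j => rfl) (hpos m)⟩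
  · exact (Real.continuous_exp.tendsto _).comp ((((((lf_self_tendsto).const_mul (2 * (n : ℝ))).sub
      (lf_mul_tendsto n)).sub (tendsto_finsetSum _ fun i _ => tendsto_finsetSum _ fun j _ =>
        asym (hkd i j))).add (tendsto_finsetSum _ fun i _ => tendsto_finsetSum _ fun j _ =>
        (hkd i j).mul_const (log (A i j)))).div_const (n : ℝ))
  · rw [sm, Fintype.card_fin, ← exp_log (show 0 < ((n : ℝ) * n)⁻¹ * sInf (smSet A) by positivity)]
    apply exp_le_exp.2
    rw [log_mul (by positivity) (by positivity), log_inv, log_mul (by positivity) (by positivity),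
      le_div_iff₀ hn']
    have hS : ∑ i, ∑ j, K i j = 1 := by
      simp only [hKr]; simp [hn'.ne']
    have e1 : ∑ i, ∑ j, (-negMulLog (n * K i j) - n * K i j) =
        - n * (∑ i, ∑ j, negMulLog (K i j)) + n * log n - n := by
      simp only [negMulLog_mul, neg_add, Finset.sum_sub_distrib, Finset.sum_add_distrib,
        Finset.sum_neg_distrib, ← Finset.sum_mul, ← Finset.mul_sum, hS]
      simp only [negMulLog]; ring
    have e2 : ∑ i, ∑ j, n * K i j * log (A i j) = n * ∑ i, ∑ j, K i j * log (A i j) := by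
      simp only [mul_assoc, ← Finset.mul_sum]
    rw [e1, e2]
    simp only [Finset.sum_add_distrib] at hKG
    have := mul_le_mul_of_nonneg_left hKG hn'.le
    linarith

end Main

/-- Generalized Friedland limit: `sm(A) = lim_{m→∞} pm(A ⊗ Uₘ)`,
where `Uₘ` is the all-ones `m × m` matrix. -/
theorem stmt_3 {n : ℕ} (hn : 0 < n) (A : Matrix (Fin n) (Fin n) ℝ)
    (hA : ∀ i j, 0 ≤ A i j) :
    Filter.Tendsto
      (fun m : ℕ => pm (A ⊗ₖ (Matrix.of fun _ _ : Fin m => (1 : ℝ))))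
      Filter.atTop (nhds (sm A)) := by
  have hn' : (0 : ℝ) < n := by exact_mod_cast hn
  have hnn : (smSet A).Nonempty :=
    ⟨_, fun _ => 1, fun _ => 1, fun _ => one_pos, fun _ => one_pos, rfl⟩
  have hc0 : 0 ≤ sInf (smSet A) := le_csInf hnn (bddBelow_smSet A hA)
  -- upper bound
  have hup : Filter.Tendsto (fun m : ℕ =>
      Real.exp ((2 * n * lf m m - 2 * lf (n * m) m) / n) * sInf (smSet A))
      Filter.atTop (nhds (sm A)) := by
    have h := ((Real.continuous_exp.tendsto _).comp
      (((lf_self_tendsto.const_mul (2 * (n : ℝ))).sub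
        ((lf_mul_tendsto n).const_mul 2)).div_const (n : ℝ))).mul_const (sInf (smSet A))
    have e : Real.exp ((2 * (n : ℝ) * -1 - 2 * (n * Real.log n - n)) / n) = ((n : ℝ) * n)⁻¹ := by
      rw [← Real.exp_log (show 0 < ((n : ℝ) * n)⁻¹ by positivity)]
      congr 1
      rw [Real.log_inv, Real.log_mul (by positivity) (by positivity)]
      field_simp
      ring
    rw [e] at h
    simpa [sm, Function.comp_def] using h
  have hupm : ∀ᶠ m : ℕ in Filter.atTop, pm (A ⊗ₖ (Matrix.of fun _ _ : Fin m => (1 : ℝ))) ≤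
      Real.exp ((2 * n * lf m m - 2 * lf (n * m) m) / n) * sInf (smSet A) := by
    filter_upwards [Filter.eventually_ge_atTop 1] with m hm
    rw [← div_le_iff₀' (Real.exp_pos _)]
    refine le_csInf hnn fun r hr => ?_
    rw [div_le_iff₀' (Real.exp_pos _)]
    exact pm_upper hn hm A hA r hr
  rcases hc0.eq_or_lt with hc | hc
  · have hs0 : sm A = 0 := by simp [sm, ← hc]
    refine tendsto_of_tendsto_of_tendsto_of_le_of_le' (g := fun _ => sm A)
      tendsto_const_nhds hup ?_ hupm
    refine Filter.Eventually.of_forall fun m => ?_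
    rw [hs0]
    refine Real.rpow_nonneg (div_nonneg (perm_nonneg' _ fun i j => ?_) (by positivity)) _
    simp [Matrix.kroneckerMap_apply, hA]
  · obtain ⟨L, ℓ, hL, hle, hLm⟩ := lower_seq hn A hA hc
    have h1 : Filter.Tendsto (fun m => min (L m) (sm A)) Filter.atTop (nhds (sm A)) := by
      have := hL.min (tendsto_const_nhds (x := sm A))
      rwa [min_eq_right hle] at this
    refine tendsto_of_tendsto_of_tendsto_of_le_of_le' h1 hup ?_ hupm
    filter_upwards [Filter.eventually_ge_atTop 1] with m hm
    exact (min_le_left _ _).trans (hLm m hm)
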